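/- For every a ∈ ℝ there is no sequence β : ℤ → ℂ that is an admissible zero-mean symbol for (a, −1). (Equivalently: the functional equation characterizing a Fourier-type metric realization of m_t + u m_x + b u_x m = 0, m = (−Δ)^{a/2}u, on Diff_0^∞(S^1) has no solution when b = −1.) -/

import Mathlib

/-- Real power `|n|^a` of the absolute value of an integer. -/
noncomputable def rpAbs (a : ℝ) (n : ℤ) : ℝ := |(n : ℝ)| ^ a

/-- `β : ℤ → ℂ` is an admissible zero-mean symbol for `(a, b)`:
(i) `β 0 = 0`; (ii) `β k ≠ 0` for `k ≠ 0`;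
(iii) for nonzero `j, k` with `j + k ≠ 0`,
  `|j+k|^a (β j (2k+j) + β k (2j+k)) = β (j+k) (b (k|j|^a + j|k|^a) + k|k|^a + j|j|^a)`;
(iv) for nonzero `j, k` with `j + k = 0`, `β j (2k+j) + β k (2j+k) = 0`. -/
def AdmissibleZeroMeanSymbol (a b : ℝ) (β : ℤ → ℂ) : Prop :=
  β 0 = 0 ∧
  (∀ k : ℤ, k ≠ 0 → β k ≠ 0) ∧
  (∀ j k : ℤ, j ≠ 0 → k ≠ 0 → j + k ≠ 0 →
    (rpAbs a (j + k) : ℂ) * (β j * (2 * (k : ℂ) + (j : ℂ)) + β k * (2 * (j : ℂ) + (k : ℂ))) =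
      β (j + k) *
        ((b * ((k : ℝ) * rpAbs a j + (j : ℝ) * rpAbs a k) +
            (k : ℝ) * rpAbs a k + (j : ℝ) * rpAbs a j : ℝ) : ℂ)) ∧
  (∀ j k : ℤ, j ≠ 0 → k ≠ 0 → j + k = 0 →
    β j * (2 * (k : ℂ) + (j : ℂ)) + β k * (2 * (j : ℂ) + (k : ℂ)) = 0)

theorem no_admissible_zero_mean_symbol_b_neg_one (a : ℝ) :
    ¬ ∃ β : ℤ → ℂ, AdmissibleZeroMeanSymbol a (-1) β := by
  rintro ⟨β, -, hne, hfun, -⟩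
  have h := hfun 1 1 one_ne_zero one_ne_zero (by norm_num)
  have hpow : (rpAbs a (1 + 1) : ℂ) ≠ 0 := by
    have : 0 < rpAbs a (1 + 1) := Real.rpow_pos_of_pos (by norm_num) a
    exact_mod_cast this.ne'
  have hcoeff : (-1 * (((1 : ℤ) : ℝ) * rpAbs a 1 + ((1 : ℤ) : ℝ) * rpAbs a 1) +
      ((1 : ℤ) : ℝ) * rpAbs a 1 + ((1 : ℤ) : ℝ) * rpAbs a 1 : ℝ) = 0 := by ring
  rw [hcoeff, Complex.ofReal_zero, mul_zero] at h
  have hβ := (mul_eq_zero.mp h).resolve_left hpow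
  push_cast at hβ
  exact hne 1 one_ne_zero (by linear_combination hβ / 6)
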